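/- arXiv:1605.02715 — 2 statements merged into one kernel-verified Lean document; each statement's English description precedes it below -/
import Mathlib

section
/- Kac's formula for suspension semi-flows, ergodic case: if T is ergodic with respect to μ and μ(D) > 0, then ∫_D S_{n_D(y)}(y) dμ(y) = ∫_Y r dμ, i.e. the mean return time of the suspension semi-flow to the section D × {0}, integrated over D with respect to μ, equals the mean of the roof function. -/
open MeasureTheory Set Filter
open scoped ENNReal ENat

/-- The first entry index `n_D(y) = inf {n ≥ 1 : Tⁿ y ∈ D} ∈ ℕ ∪ {∞}`, with `inf ∅ = ∞`. -/
noncomputable def entryIdx {Y : Type*} (T : Y → Y) (D : Set Y) (y : Y) : ℕ∞ :=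
  sInf {m : ℕ∞ | ∃ n : ℕ, 1 ≤ n ∧ T^[n] y ∈ D ∧ m = n}

/-- The Birkhoff sum `S_n(y) = ∑_{j=0}^{n-1} r(Tʲ y)`. -/
noncomputable def birkhoff {Y : Type*} (T : Y → Y) (r : Y → ℝ) (n : ℕ) (y : Y) : ℝ :=
  ∑ j ∈ Finset.range n, r (T^[j] y)

/-- The Birkhoff sum `S_n(y)` with extended index `n ∈ ℕ ∪ {∞}`, interpreted as `+∞`
when `n = ∞`. -/
noncomputable def birkhoffE {Y : Type*} (T : Y → Y) (r : Y → ℝ) (n : ℕ∞) (y : Y) : ℝ≥0∞ :=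
  if n = ⊤ then ⊤ else ENNReal.ofReal (birkhoff T r n.toNat y)

/-- No visit to `D` at times `1..n`. -/
def noVisit {Y : Type*} (T : Y → Y) (D : Set Y) (n : ℕ) : Set Y :=
  {y | ∀ j, 1 ≤ j → j ≤ n → T^[j] y ∉ D}

theorem noVisit_meas {Y : Type*} [MeasurableSpace Y] {T : Y → Y} (hT : Measurable T)
    {D : Set Y} (hD : MeasurableSet D) (n : ℕ) : MeasurableSet (noVisit T D n) := by
  have : noVisit T D n = ⋂ j, ⋂ (_ : 1 ≤ j), ⋂ (_ : j ≤ n), (T^[j] ⁻¹' D)ᶜ := by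
    ext y; simp [noVisit]
  rw [this]
  exact MeasurableSet.iInter fun j => MeasurableSet.iInter fun _ => MeasurableSet.iInter fun _ =>
    ((hT.iterate j) hD).compl

theorem noVisit_preimage {Y : Type*} (T : Y → Y) (D : Set Y) (n : ℕ) :
    T ⁻¹' (noVisit T D n \ D) = noVisit T D (n + 1) := by
  ext y
  simp only [noVisit, mem_preimage, mem_diff, mem_setOf_eq]
  constructor
  · rintro ⟨h1, h2⟩ j hj hjn
    obtain ⟨k, rfl⟩ : ∃ k, j = k + 1 := ⟨j - 1, by omega⟩
    rw [Function.iterate_succ_apply]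
    rcases Nat.eq_zero_or_pos k with rfl | hk
    · simpa using h2
    · exact h1 k hk (by omega)
  · intro h
    refine ⟨fun j hj hjn => ?_, ?_⟩
    · rw [← Function.iterate_succ_apply]
      exact h (j + 1) (by omega) (by omega)
    · simpa using h 1 le_rfl (by omega)

theorem noVisit_tendsto {Y : Type*} [MeasurableSpace Y] (μ : Measure Y) [IsProbabilityMeasure μ]
    (T : Y → Y) (hT : Ergodic T μ) (D : Set Y) (hD : MeasurableSet D) (hDpos : μ D ≠ 0) :
    Tendsto (fun n => μ (noVisit T D n)) atTop (nhds 0) := by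
  have hTm := hT.measurable
  set F : Set Y := ⋂ n, noVisit T D n with hF
  have hFm : MeasurableSet F := MeasurableSet.iInter fun n => noVisit_meas hTm hD n
  have hsub : F ⊆ T ⁻¹' F := by
    intro y hy
    simp only [hF, mem_iInter, mem_preimage] at hy ⊢
    intro n j hj hjn
    rw [← Function.iterate_succ_apply]
    exact hy (j + 1) (j + 1) (by omega) le_rfl
  have h0 : μ F = 0 := by
    rcases hT.ae_empty_or_univ_of_ae_le_preimage' hFm.nullMeasurableSet
      (Filter.Eventually.of_forall hsub) (measure_ne_top _ _) with h | h
    · exact ae_eq_empty.1 h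
    · exfalso
      apply hDpos
      rw [← hT.measure_preimage hD.nullMeasurableSet]
      have h2 : μ Fᶜ = 0 := ae_eq_univ.1 h
      refine measure_mono_null (t := Fᶜ) ?_ h2
      intro y hy hyF
      simp only [hF, mem_iInter] at hyF
      exact hyF 1 1 le_rfl le_rfl hy
  rw [← h0]
  refine tendsto_measure_iInter_atTop (fun n => (noVisit_meas hTm hD n).nullMeasurableSet) ?_
    ⟨0, measure_ne_top _ _⟩
  intro m n hmn y hy j hj hjm
  exact hy j hj (hjm.trans hmn)

theorem kac_measure {Y : Type*} [MeasurableSpace Y] (μ : Measure Y) [IsProbabilityMeasure μ]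
    (T : Y → Y) (hT : Ergodic T μ) (D : Set Y) (hD : MeasurableSet D) (hDpos : μ D ≠ 0) :
    Measure.sum (fun n => ((μ.restrict D).restrict (noVisit T D n)).map T^[n]) = μ := by
  have hTm := hT.measurable
  ext s hs
  rw [Measure.sum_apply _ hs]
  have hB : ∀ n, (((μ.restrict D).restrict (noVisit T D n)).map T^[n]) s
      = μ ((T^[n] ⁻¹' s ∩ noVisit T D n) ∩ D) := by
    intro n
    have h1 := (hTm.iterate n) hs
    rw [Measure.map_apply (hTm.iterate n) hs, Measure.restrict_apply h1,
      Measure.restrict_apply (h1.inter (noVisit_meas hTm hD n))]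
  simp_rw [hB]
  have hsum : ∀ N, ∑ n ∈ Finset.range N, μ ((T^[n] ⁻¹' s ∩ noVisit T D n) ∩ D)
      + μ (T^[N] ⁻¹' s ∩ noVisit T D N) = μ s := by
    intro N
    induction N with
    | zero =>
      have : noVisit T D 0 = univ := by
        ext y; simp only [noVisit, mem_setOf_eq, mem_univ, iff_true]; intro j h1 h2; omega
      simp [this]
    | succ N ih =>
      rw [← ih, Finset.sum_range_succ, add_assoc, ← measure_inter_add_diff (T^[N] ⁻¹' s ∩ noVisit T D N) hD]
      congr 2
      have hm : MeasurableSet ((T^[N] ⁻¹' s ∩ noVisit T D N) \ D) :=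
        (((hTm.iterate N) hs).inter (noVisit_meas hTm hD N)).diff hD
      rw [← hT.measure_preimage hm.nullMeasurableSet, inter_diff_assoc, preimage_inter,
        noVisit_preimage, ← preimage_comp, ← Function.iterate_succ]
  have hlim : Tendsto (fun N => μ (T^[N] ⁻¹' s ∩ noVisit T D N)) atTop (nhds 0) :=
    tendsto_of_tendsto_of_tendsto_of_le_of_le tendsto_const_nhds
      (noVisit_tendsto μ T hT D hD hDpos) (fun _ => zero_le)
      (fun _ => measure_mono inter_subset_right)
  have h2 := (ENNReal.summable (f := fun n => μ ((T^[n] ⁻¹' s ∩ noVisit T D n) ∩ D))).hasSum.tendsto_sum_nat.add hlim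
  simp_rw [hsum, add_zero] at h2
  exact tendsto_nhds_unique h2 tendsto_const_nhds

theorem birkhoffE_eq {Y : Type*} (T : Y → Y) (r : Y → ℝ) (c : ℝ) (hc : 0 < c)
    (hcr : ∀ y, c ≤ r y) (D : Set Y) (y : Y) :
    birkhoffE T r (entryIdx T D y) y
      = ∑' n, (noVisit T D n).indicator (fun y => ENNReal.ofReal (r (T^[n] y))) y := by
  by_cases h : ∃ n, 1 ≤ n ∧ T^[n] y ∈ D
  · classical
    obtain ⟨h1, h2⟩ := Nat.find_spec h
    have hmin := fun m (hm : m < Nat.find h) => Nat.find_min h hm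
    set N := Nat.find h
    have hN : entryIdx T D y = N := by
      apply le_antisymm
      · exact sInf_le ⟨N, h1, h2, rfl⟩
      · refine le_sInf ?_
        rintro _ ⟨n, hn, hn2, rfl⟩
        by_contra hlt
        exact hmin n (by simpa using hlt) ⟨hn, hn2⟩
    rw [hN, birkhoffE, if_neg (ENat.coe_ne_top N), ENat.toNat_coe, birkhoff,
      ENNReal.ofReal_sum_of_nonneg (fun i _ => hc.le.trans (hcr _)),
      tsum_eq_sum (s := Finset.range N)]
    · refine Finset.sum_congr rfl fun n hn => ?_
      rw [indicator_of_mem]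
      intro j hj hjn hjD
      exact hmin j (lt_of_le_of_lt hjn (Finset.mem_range.1 hn)) ⟨hj, hjD⟩
    · intro n hn
      rw [indicator_of_notMem]
      intro hy
      exact hy N h1 (by simpa using hn) h2
  · have hN : entryIdx T D y = ⊤ := by
      rw [entryIdx, sInf_eq_top]
      rintro _ ⟨n, hn, hn2, rfl⟩
      exact absurd ⟨n, hn, hn2⟩ h
    rw [hN, birkhoffE, if_pos rfl]
    symm
    rw [eq_top_iff, ← ENNReal.tsum_const_eq_top_of_ne_zero (α := ℕ) (c := ENNReal.ofReal c) (by simpa using hc)]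
    refine ENNReal.tsum_le_tsum fun n => ?_
    rw [indicator_of_mem]
    · exact ENNReal.ofReal_le_ofReal (hcr _)
    · intro j hj _ hjD
      exact h ⟨j, hj, hjD⟩

/-- Kac's formula for suspension semi-flows, ergodic case: if `T` is ergodic and `μ D > 0`,
then `∫_D S_{n_D(y)}(y) dμ(y) = ∫_Y r dμ`. -/
theorem kac_formula_suspension_ergodic
    {Y : Type*} [MeasurableSpace Y] (μ : Measure Y) [IsProbabilityMeasure μ]
    (T : Y → Y) (hT : Ergodic T μ)
    (r : Y → ℝ) (hrm : Measurable r) (hri : Integrable r μ)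
    (c : ℝ) (hc : 0 < c) (hcr : ∀ y, c ≤ r y)
    (D : Set Y) (hD : MeasurableSet D) (hDpos : μ D ≠ 0) :
    ∫⁻ y in D, birkhoffE T r (entryIdx T D y) y ∂μ = ENNReal.ofReal (∫ y, r y ∂μ) := by
  have hTm := hT.measurable
  have hfm : Measurable fun y => ENNReal.ofReal (r y) := hrm.ennreal_ofReal
  rw [ofReal_integral_eq_lintegral_ofReal hri
    (Filter.Eventually.of_forall fun y => hc.le.trans (hcr y))]
  conv_rhs => rw [← kac_measure μ T hT D hD hDpos]
  simp_rw [birkhoffE_eq T r c hc hcr D]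
  rw [lintegral_sum_measure, lintegral_tsum]
  · refine tsum_congr fun n => ?_
    rw [lintegral_map hfm (hTm.iterate n), lintegral_indicator (noVisit_meas hTm hD n)]
  · intro n
    exact ((hfm.comp (hTm.iterate n)).indicator (noVisit_meas hTm hD n)).aemeasurable
end

section
/- Stationarity of the entry-time point process: for every measurable set D ∈ 𝒜 and every u ≥ 0, the pushforward of ν̃ under the map (y,s) ↦ θ₊^u Φ(y,s) equals the pushforward of ν̃ under Φ, where for a Borel measure ζ on ℝ the shifted measure θ₊^u ζ is defined by (θ₊^u ζ)(B) = ζ((B ∩ (0,∞)) + u) for Borel B ⊆ ℝ. In other words, the point process of entry times to the section D × {0}, started from a ν̃-random point of the suspension, is stationary on (0,∞). -/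
open MeasureTheory Set Filter
open scoped ENNReal

/-- The invariant probability measure `ν̃` of the suspension semi-flow with roof function `r`
over `(Y, μ, T)`: `ν̃(A) = r̄⁻¹ ∫_Y Leb{s ∈ [0, r(y)) : (y,s) ∈ A} dμ(y)`. -/
noncomputable def suspensionMeasure {Y : Type*} [MeasurableSpace Y]
    (μ : Measure Y) (r : Y → ℝ) : Measure (Y × ℝ) :=
  (ENNReal.ofReal (∫ y, r y ∂μ))⁻¹ •
    ((μ.prod volume).restrict {p : Y × ℝ | 0 ≤ p.2 ∧ p.2 < r p.1})

/-- The entry-time point measure `Φ(y,s) = ∑_{n ≥ 1, Tⁿ y ∈ D} δ_{S_n(y) − s}`, a Borel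
measure on `ℝ` supported in `(0,∞)`. -/
noncomputable def entryProcess {Y : Type*} (T : Y → Y) (r : Y → ℝ) (D : Set Y)
    (x : Y × ℝ) : Measure ℝ :=
  Measure.sum fun n : ℕ =>
    {n : ℕ | 1 ≤ n ∧ T^[n] x.1 ∈ D}.indicator
      (fun n => Measure.dirac (birkhoff T r n x.1 - x.2)) n

/-- The one-sided shift `θ₊^u` on measures on `ℝ`: `(θ₊^u ζ)(B) = ζ((B ∩ (0,∞)) + u)`. -/
noncomputable def shiftPos (u : ℝ) (ζ : Measure ℝ) : Measure ℝ :=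
  Measure.map (fun t => t - u) (ζ.restrict (Set.Ioi u))

theorem ep_meas_birkhoff {Y : Type*} [MeasurableSpace Y] {T : Y → Y} {r : Y → ℝ}
    (hT : Measurable T) (hr : Measurable r) (n : ℕ) : Measurable (birkhoff T r n) := by
  unfold birkhoff
  exact Finset.measurable_sum _ fun j _ => hr.comp (hT.iterate j)

theorem ep_birkhoff_succ {Y : Type*} (T : Y → Y) (r : Y → ℝ) (n : ℕ) (y : Y) :
    birkhoff T r (n + 1) y = r y + birkhoff T r n (T y) := by
  unfold birkhoff
  rw [Finset.sum_range_succ', add_comm]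
  simp

theorem ep_apply {Y : Type*} (T : Y → Y) (r : Y → ℝ) (D : Set Y) (x : Y × ℝ)
    {B : Set ℝ} (hB : MeasurableSet B) :
    entryProcess T r D x B = ∑' n : ℕ,
      {p : Y × ℝ | 1 ≤ n ∧ T^[n] p.1 ∈ D ∧ birkhoff T r n p.1 - p.2 ∈ B}.indicator
        (fun _ => (1 : ℝ≥0∞)) x := by
  unfold entryProcess
  rw [Measure.sum_apply _ hB]
  congr 1
  funext n
  by_cases h : 1 ≤ n ∧ T^[n] x.1 ∈ D
  · by_cases h2 : birkhoff T r n x.1 - x.2 ∈ B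
    · simp [Set.indicator, h, h2, Measure.dirac_apply' _ hB]
    · simp [Set.indicator, h, h2, Measure.dirac_apply' _ hB]
  · have h3 : ¬ (1 ≤ n ∧ T^[n] x.1 ∈ D ∧ birkhoff T r n x.1 - x.2 ∈ B) := by tauto
    simp only [Set.indicator, Set.mem_ofPred_eq, if_neg h, if_neg h3]
    simp

theorem ep_meas {Y : Type*} [MeasurableSpace Y] {T : Y → Y} {r : Y → ℝ} {D : Set Y}
    (hT : Measurable T) (hr : Measurable r) (hD : MeasurableSet D) :
    Measurable (entryProcess T r D) := by
  refine Measure.measurable_of_measurable_coe _ fun B hB => ?_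
  simp only [ep_apply T r D _ hB]
  refine Measurable.ennreal_tsum fun n => measurable_const.indicator ?_
  refine (MeasurableSet.const _).inter (MeasurableSet.inter ?_ ?_)
  · exact ((hT.iterate n).comp measurable_fst) hD
  · exact (((ep_meas_birkhoff hT hr n).comp measurable_fst).sub measurable_snd) hB

/-- The entry process restricted to positive times. -/
noncomputable def epPos {Y : Type*} (T : Y → Y) (r : Y → ℝ) (D : Set Y)
    (x : Y × ℝ) : Measure ℝ := (entryProcess T r D x).restrict (Ioi 0)

theorem epPos_meas {Y : Type*} [MeasurableSpace Y] {T : Y → Y} {r : Y → ℝ} {D : Set Y}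
    (hT : Measurable T) (hr : Measurable r) (hD : MeasurableSet D) :
    Measurable (epPos T r D) := by
  refine Measure.measurable_of_measurable_coe _ fun B hB => ?_
  simp only [epPos, Measure.restrict_apply hB]
  exact (Measure.measurable_coe (hB.inter measurableSet_Ioi)).comp (ep_meas hT hr hD)

theorem epPos_apply {Y : Type*} (T : Y → Y) (r : Y → ℝ) (D : Set Y) (x : Y × ℝ)
    {B : Set ℝ} (hB : MeasurableSet B) :
    epPos T r D x B = ∑' n : ℕ,
      {p : Y × ℝ | 1 ≤ n ∧ T^[n] p.1 ∈ D ∧ birkhoff T r n p.1 - p.2 ∈ B ∩ Ioi 0}.indicator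
        (fun _ => (1 : ℝ≥0∞)) x := by
  rw [epPos, Measure.restrict_apply hB, ep_apply _ _ _ _ (hB.inter measurableSet_Ioi)]

theorem ep_shift {Y : Type*} (T : Y → Y) (r : Y → ℝ) (D : Set Y) (u : ℝ) (x : Y × ℝ) :
    shiftPos u (entryProcess T r D x) = epPos T r D (x.1, x.2 + u) := by
  ext B hB
  have hm : Measurable (fun t : ℝ => t - u) := measurable_id.sub_const u
  rw [shiftPos, Measure.map_apply hm hB, Measure.restrict_apply (hm hB),
    ep_apply _ _ _ _ ((hm hB).inter measurableSet_Ioi), epPos_apply _ _ _ _ hB]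
  congr 1
  funext n
  simp only [Set.indicator, Set.mem_ofPred_eq]
  congr 1
  apply propext
  simp only [Set.mem_inter_iff, Set.mem_preimage, Set.mem_Ioi, ← sub_sub, sub_pos]

theorem ep_base {Y : Type*} (T : Y → Y) (r : Y → ℝ) (D : Set Y)
    (hr : ∀ y, 0 ≤ r y) (x : Y × ℝ) (hx : x.2 < r x.1) :
    entryProcess T r D x = epPos T r D x := by
  ext B hB
  rw [ep_apply _ _ _ _ hB, epPos_apply _ _ _ _ hB]
  congr 1
  funext n
  have key : 1 ≤ n → 0 < birkhoff T r n x.1 - x.2 := by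
    intro hn
    obtain ⟨m, rfl⟩ := Nat.exists_eq_add_of_le' hn
    rw [ep_birkhoff_succ]
    have : 0 ≤ birkhoff T r m (T x.1) := Finset.sum_nonneg fun j _ => hr _
    linarith
  simp only [Set.indicator, Set.mem_ofPred_eq]
  congr 1
  apply propext
  simp only [Set.mem_inter_iff, Set.mem_Ioi]
  tauto

theorem ep_step {Y : Type*} (T : Y → Y) (r : Y → ℝ) (D : Set Y)
    (y : Y) (t : ℝ) (ht : 0 ≤ t) :
    epPos T r D (y, t + r y) = epPos T r D (T y, t) := by
  ext B hB
  rw [epPos_apply _ _ _ _ hB, epPos_apply _ _ _ _ hB, tsum_eq_zero_add' ENNReal.summable]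
  have h0 : ({p : Y × ℝ | 1 ≤ 0 ∧ T^[0] p.1 ∈ D ∧ birkhoff T r 0 p.1 - p.2 ∈ B ∩ Ioi 0}.indicator
        (fun _ => (1 : ℝ≥0∞)) (y, t + r y)) = 0 := by
    simp [Set.indicator]
  rw [h0, zero_add]
  congr 1
  funext n
  have e : birkhoff T r (n + 1) y - (t + r y) = birkhoff T r n (T y) - t := by
    rw [ep_birkhoff_succ]; ring
  simp only [Set.indicator, Set.mem_ofPred_eq]
  congr 1
  apply propext
  rw [e, Function.iterate_succ_apply]
  constructor
  · rintro ⟨-, h2, h3⟩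
    refine ⟨?_, h2, h3⟩
    rcases Nat.eq_zero_or_pos n with rfl | hn
    · have := h3.2
      simp only [birkhoff, Finset.range_zero, Finset.sum_empty, Set.mem_Ioi] at this
      linarith
    · exact hn
  · rintro ⟨-, h2, h3⟩
    exact ⟨by omega, h2, h3⟩

theorem ep_vol (P Q : Set ℝ) (hP : MeasurableSet P) (a b : ℝ) (ha : 0 ≤ a) (hb : 0 ≤ b)
    (hPQ : ∀ t, 0 ≤ t → (t + a ∈ P ↔ t ∈ Q)) :
    volume (Ico 0 a ∩ P) + volume (Ico 0 b ∩ Q) = volume (Ico 0 (a + b) ∩ P) := by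
  have e : Ico 0 b ∩ Q = (fun t => t + a) ⁻¹' (Ico a (a + b) ∩ P) := by
    ext t
    simp only [Set.mem_inter_iff, Set.mem_Ico, Set.mem_preimage]
    constructor
    · rintro ⟨⟨h1, h2⟩, h3⟩
      exact ⟨⟨by linarith, by linarith⟩, (hPQ t h1).2 h3⟩
    · rintro ⟨⟨h1, h2⟩, h3⟩
      have h4 : 0 ≤ t := by linarith
      exact ⟨⟨h4, by linarith⟩, (hPQ t h4).1 h3⟩
  rw [e, measure_preimage_add_right, ← measure_union _ (measurableSet_Ico.inter hP),
    ← Set.union_inter_distrib_right, Set.Ico_union_Ico_eq_Ico ha (by linarith)]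
  refine Set.disjoint_left.2 ?_
  rintro t ⟨⟨_, h1⟩, _⟩ ⟨⟨h2, _⟩, _⟩
  linarith

/-- Stationarity of the entry-time point process on `(0,∞)`: for every measurable `D` and
`u ≥ 0`, the law of `θ₊^u Φ(y,s)` under `ν̃` equals the law of `Φ(y,s)` under `ν̃`. -/
theorem entry_process_stationary
    {Y : Type*} [MeasurableSpace Y] (μ : Measure Y) [IsProbabilityMeasure μ]
    (T : Y → Y) (hT : MeasurePreserving T μ μ)
    (r : Y → ℝ) (hrm : Measurable r) (hri : Integrable r μ)
    (c : ℝ) (hc : 0 < c) (hcr : ∀ y, c ≤ r y)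
    (D : Set Y) (hD : MeasurableSet D) (u : ℝ) (hu : 0 ≤ u) :
    Measure.map (fun x => shiftPos u (entryProcess T r D x)) (suspensionMeasure μ r)
      = Measure.map (entryProcess T r D) (suspensionMeasure μ r) := by
  have hTm := hT.measurable
  have hG := epPos_meas (D := D) hTm hrm hD
  have hr0 : ∀ y, 0 ≤ r y := fun y => hc.le.trans (hcr y)
  have hsh : Measurable (fun x : Y × ℝ => (x.1, x.2 + u)) := by fun_prop
  have hGs : Measurable (fun x : Y × ℝ => epPos T r D (x.1, x.2 + u)) := hG.comp hsh
  have hS : MeasurableSet {p : Y × ℝ | 0 ≤ p.2 ∧ p.2 < r p.1} :=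
    (measurableSet_le measurable_const measurable_snd).inter
      (measurableSet_lt measurable_snd (hrm.comp measurable_fst))
  have hU : MeasurableSet {p : Y × ℝ | 0 ≤ p.2 ∧ p.2 < u} :=
    (measurableSet_le measurable_const measurable_snd).inter
      (measurableSet_lt measurable_snd measurable_const)
  simp only [ep_shift]
  unfold suspensionMeasure
  rw [Measure.map_smul, Measure.map_smul]
  congr 1
  ext A hA
  rw [Measure.map_apply hGs hA, Measure.map_apply (ep_meas hTm hrm hD) hA,
    Measure.restrict_apply (hGs hA), Measure.restrict_apply (ep_meas hTm hrm hD hA)]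
  set H : Set (Y × ℝ) := epPos T r D ⁻¹' A with hHdef
  have hH : MeasurableSet H := hG hA
  have e2 : entryProcess T r D ⁻¹' A ∩ {p : Y × ℝ | 0 ≤ p.2 ∧ p.2 < r p.1}
      = {p : Y × ℝ | 0 ≤ p.2 ∧ p.2 < r p.1} ∩ H := by
    ext p
    simp only [Set.mem_inter_iff, Set.mem_preimage, Set.mem_ofPred_eq, hHdef]
    constructor
    · rintro ⟨h1, h2⟩
      exact ⟨h2, by rwa [← ep_base T r D hr0 p h2.2]⟩
    · rintro ⟨h2, h1⟩
      exact ⟨by rwa [ep_base T r D hr0 p h2.2], h2⟩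
  have e1 : (fun x : Y × ℝ => epPos T r D (x.1, x.2 + u)) ⁻¹' A
        ∩ {p : Y × ℝ | 0 ≤ p.2 ∧ p.2 < r p.1}
      = {p : Y × ℝ | 0 ≤ p.2 ∧ p.2 < r p.1} ∩ (fun x : Y × ℝ => (x.1, x.2 + u)) ⁻¹' H :=
    Set.inter_comm _ _
  have m1 := hS.inter (hsh hH)
  have m2 := hS.inter hH
  have m3 := hU.inter hH
  have key : ∀ y, volume (Prod.mk y ⁻¹' ({p : Y × ℝ | 0 ≤ p.2 ∧ p.2 < u} ∩ H))
      + volume (Prod.mk y ⁻¹' ({p : Y × ℝ | 0 ≤ p.2 ∧ p.2 < r p.1}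
          ∩ (fun x : Y × ℝ => (x.1, x.2 + u)) ⁻¹' H))
      = volume (Prod.mk y ⁻¹' ({p : Y × ℝ | 0 ≤ p.2 ∧ p.2 < r p.1} ∩ H))
      + volume (Prod.mk (T y) ⁻¹' ({p : Y × ℝ | 0 ≤ p.2 ∧ p.2 < u} ∩ H)) := by
    intro y
    have hP : MeasurableSet (Prod.mk y ⁻¹' H) := measurable_prodMk_left hH
    have k1 := ep_vol (Prod.mk y ⁻¹' H) {t | (y, t + u) ∈ H} hP u (r y) hu (hr0 y)
      (fun t _ => Iff.rfl)
    have k2 := ep_vol (Prod.mk y ⁻¹' H) (Prod.mk (T y) ⁻¹' H) hP (r y) u (hr0 y) hu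
      (fun t ht => by simp only [Set.mem_preimage, hHdef, ep_step T r D y t ht])
    rw [add_comm u (r y)] at k1
    exact k1.trans k2.symm
  have hint := lintegral_congr (μ := μ) key
  rw [lintegral_add_left (measurable_measure_prodMk_left m3),
    lintegral_add_left (measurable_measure_prodMk_left m2),
    hT.lintegral_comp (measurable_measure_prodMk_left (ν := (volume : Measure ℝ)) m3),
    add_comm] at hint
  have hfin : ∫⁻ y, volume (Prod.mk y ⁻¹' ({p : Y × ℝ | 0 ≤ p.2 ∧ p.2 < u} ∩ H)) ∂μ ≠ ⊤ := by
    refine ne_top_of_le_ne_top (b := ENNReal.ofReal u) ENNReal.ofReal_ne_top ?_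
    calc _ ≤ ∫⁻ _, ENNReal.ofReal u ∂μ := by
          refine lintegral_mono fun y => ?_
          refine (measure_mono (t := Ico 0 u) fun t ht => ht.1).trans ?_
          simp
      _ = _ := by simp
  rw [e2]
  refine (congrArg _ e1).trans ?_
  rw [Measure.prod_apply m1, Measure.prod_apply m2]
  exact (ENNReal.add_left_inj hfin).1 hint
end
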